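/- arXiv:1010.2793 — 3 statements merged into one kernel-verified Lean document; each statement's English description precedes it below -/
import Mathlib

section
/- Let A = ℂ^a and B = ℂ^b, let φ0, φ1 be unit vectors in A ⊗ B such that the reduced density matrices Tr_B |φ0⟩⟨φ0| and Tr_B |φ1⟩⟨φ1| are orthogonal (their matrix product is 0), and let k ≥ 1. Then for all density matrices ρ0, ρ1 on (A ⊗ B)^{⊗k} satisfying Tr over all k copies of B of ρ0 equals Tr over all k copies of B of ρ1, it holds that (1/2)(T_{φ0}(ρ0) + T_{φ1}(ρ1)) ≤ 1/2 + 1/2^{k+1}, where T_φ(ρ) is the probability that ρ passes the k-fold swap test against φ. (Parallel repetition theorem for swap-test based verification: exactly orthogonal case.) -/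
open Matrix ComplexOrder Kronecker

/-- Index of the `k`-fold tensor power `(ℂ^a ⊗ ℂ^b)^{⊗k}`. -/
abbrev TensIdx (a b k : ℕ) := Fin k → Fin a × Fin b

/-- Partial trace over the second factor `B = ℂ^b` of a matrix on `ℂ^a ⊗ ℂ^b`. -/
noncomputable def ptraceB {a b : ℕ} (M : Matrix (Fin a × Fin b) (Fin a × Fin b) ℂ) :
    Matrix (Fin a) (Fin a) ℂ :=
  Matrix.of fun i j => ∑ l : Fin b, M (i, l) (j, l)

/-- Partial trace over all `k` copies of `B = ℂ^b` of a matrix on `(ℂ^a ⊗ ℂ^b)^{⊗k}`. -/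
noncomputable def ptraceBs {a b k : ℕ} (M : Matrix (TensIdx a b k) (TensIdx a b k) ℂ) :
    Matrix (Fin k → Fin a) (Fin k → Fin a) ℂ :=
  Matrix.of fun x y => ∑ z : Fin k → Fin b, M (fun i => (x i, z i)) (fun i => (y i, z i))

/-- The `k`-fold tensor (Kronecker) power of a matrix. -/
noncomputable def tpow {n : Type*} (M : Matrix n n ℂ) (k : ℕ) :
    Matrix (Fin k → n) (Fin k → n) ℂ :=
  Matrix.of fun x y => ∏ i, M (x i) (y i)

/-- The unitary `W i` on `(ℂ^a ⊗ ℂ^b)^{⊗k} ⊗ (ℂ^a ⊗ ℂ^b)^{⊗k}` exchanging the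
`i`-th tensor factor of the first group of `k` factors with the `i`-th tensor
factor of the second group (a permutation matrix). -/
noncomputable def W (a b k : ℕ) (i : Fin k) :
    Matrix (TensIdx a b k × TensIdx a b k) (TensIdx a b k × TensIdx a b k) ℂ :=
  Matrix.of fun x y =>
    if x = (Function.update y.1 i (y.2 i), Function.update y.2 i (y.1 i)) then 1 else 0

/-- `T_φ(ρ)`, the probability that `ρ` passes the `k`-fold swap test against `φ`:
`tr[(∏_{i=1}^k (I + W_i)/2) ((|φ⟩⟨φ|)^{⊗k} ⊗ ρ)]`.  Since the `W i` pairwise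
commute, the product is taken as a list product. -/
noncomputable def swapTestProb {a b : ℕ} (k : ℕ) (φ : Fin a × Fin b → ℂ)
    (ρ : Matrix (TensIdx a b k) (TensIdx a b k) ℂ) : ℝ :=
  ((List.map (fun i => (1 / 2 : ℂ) • (1 + W a b k i)) (List.finRange k)).prod *
      (tpow (vecMulVec φ (star φ)) k ⊗ₖ ρ)).trace.re

/-- The tensor product of a family of matrices. -/
def piTensor {ι n : Type*} [Fintype ι] (F : ι → Matrix n n ℂ) : Matrix (ι → n) (ι → n) ℂ :=
  Matrix.of fun x y => ∏ i, F i (x i) (y i)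

section PiTensor

variable {ι n : Type*} [Fintype ι]

lemma piTensor_one [DecidableEq n] : piTensor (1 : ι → Matrix n n ℂ) = 1 := by
  ext x y
  simp [piTensor, Matrix.one_apply, Fintype.prod_boole, funext_iff]

lemma piTensor_conjTranspose (F : ι → Matrix n n ℂ) :
    (piTensor F)ᴴ = piTensor fun i => (F i)ᴴ := by
  ext x y
  simp [piTensor, Matrix.conjTranspose_apply]

lemma piTensor_smul (c : ι → ℂ) (F : ι → Matrix n n ℂ) :
    piTensor (fun i => c i • F i) = (∏ i, c i) • piTensor F := by
  ext x y
  simp [piTensor, Finset.prod_mul_distrib]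

variable [DecidableEq ι]

lemma piTensor_mul [Fintype n] (F G : ι → Matrix n n ℂ) :
    piTensor (F * G) = piTensor F * piTensor G := by
  ext x y
  simp [piTensor, Matrix.mul_apply, Fintype.prod_sum, Finset.prod_mul_distrib]

lemma piTensor_add (F G : ι → Matrix n n ℂ) :
    piTensor (fun i => F i + G i) =
      ∑ s : Finset ι, piTensor fun i => if i ∈ s then F i else G i := by
  ext x y
  simp only [piTensor, Matrix.of_apply, Matrix.add_apply, Matrix.sum_apply, Fintype.prod_add]
  refine Finset.sum_congr rfl fun s _ => ?_
  rw [← Finset.prod_mul_prod_compl s]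
  congr 1
  · exact Finset.prod_congr rfl fun i hi => by simp [hi]
  · exact Finset.prod_congr rfl fun i hi => by simp [Finset.mem_compl.mp hi]

lemma piTensor_smul_add_smul (E F : Matrix n n ℂ) (c d : ℂ) :
    (piTensor fun _ : ι => c • E + d • F) =
      ∑ s : Finset ι, (c ^ s.card * d ^ sᶜ.card) • piTensor fun i => if i ∈ s then E else F := by
  rw [piTensor_add]
  refine Finset.sum_congr rfl fun s _ => ?_
  have h : (∏ i, if i ∈ s then c else d) = c ^ s.card * d ^ sᶜ.card := by
    simp [Finset.prod_ite, Finset.filter_not, Finset.compl_eq_univ_sdiff]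
  rw [← h, ← piTensor_smul]
  congr 1
  funext i
  split_ifs <;> rfl

variable [Fintype n]

lemma Matrix.PosSemidef.exists_conjTranspose_mul_self {M : Matrix n n ℂ} (hM : M.PosSemidef) :
    ∃ N : Matrix n n ℂ, M = Nᴴ * N := by
  classical
  open scoped MatrixOrder in
  exact CStarAlgebra.nonneg_iff_eq_star_mul_self.mp hM.nonneg

lemma Matrix.PosSemidef.re_trace_mul_nonneg {M N : Matrix n n ℂ} (hM : M.PosSemidef)
    (hN : N.PosSemidef) : 0 ≤ (M * N).trace.re := by
  obtain ⟨L, rfl⟩ := hM.exists_conjTranspose_mul_self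
  rw [Matrix.mul_assoc, Matrix.trace_mul_comm]
  exact (Complex.le_def.mp (hN.mul_mul_conjTranspose_same L).trace_nonneg).1

lemma Matrix.posSemidef_of_isHermitian_of_mul_self {M : Matrix n n ℂ} (hM : Mᴴ = M)
    (hMM : M * M = M) : M.PosSemidef := by
  rw [← hMM]
  nth_rw 1 [← hM]
  exact posSemidef_conjTranspose_mul_self M

lemma piTensor_posSemidef {F : ι → Matrix n n ℂ} (hF : ∀ i, (F i).PosSemidef) :
    (piTensor F).PosSemidef := by
  choose N hN using fun i => (hF i).exists_conjTranspose_mul_self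
  have h : piTensor F = (piTensor N)ᴴ * piTensor N := by
    rw [piTensor_conjTranspose, ← piTensor_mul]
    exact congrArg piTensor (funext hN)
  rw [h]
  exact posSemidef_conjTranspose_mul_self _

/-- Tensor powers are monotone on positive semidefinite matrices. -/
lemma re_trace_piTensor_mul_mono {M N : Matrix n n ℂ} (hM : M.PosSemidef)
    (hMN : (N - M).PosSemidef) {ρ : Matrix (ι → n) (ι → n) ℂ} (hρ : ρ.PosSemidef) :
    ((piTensor fun _ : ι => M) * ρ).trace.re ≤ ((piTensor fun _ : ι => N) * ρ).trace.re := by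
  have h := piTensor_add (fun _ : ι => M) (fun _ => N - M)
  simp only [add_sub_cancel] at h
  rw [h, Finset.sum_mul, Matrix.trace_sum, Complex.re_sum]
  refine le_trans (le_of_eq ?_) (Finset.single_le_sum (fun s _ => ?_) (Finset.mem_univ Finset.univ))
  · simp
  · refine (piTensor_posSemidef fun i => ?_).re_trace_mul_nonneg hρ
    split_ifs <;> assumption

end PiTensor

section SwapTest

variable {n : Type*} [DecidableEq n]

/-- The projection `(I + SWAP) / 2` onto the symmetric subspace of `ℂ^n ⊗ ℂ^n`. -/
noncomputable def symProj (n : Type*) [DecidableEq n] : Matrix (n × n) (n × n) ℂ :=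
  (1 / 2 : ℂ) • (1 + Matrix.of fun x y => if x = (y.2, y.1) then 1 else 0)

lemma sum_symProj_mul [Fintype n] (P : Matrix n n ℂ) (hP : P.trace = 1) (x y : n) :
    ∑ u, ∑ v, symProj n (u, x) (v, y) * P v u = ((1 / 2 : ℂ) • (1 + P)) x y := by
  have h (u v : n) : symProj n (u, x) (v, y) * P v u =
      (1 / 2) * ((if u = v then (if x = y then P v u else 0) else 0)
        + (if u = y then (if x = v then P v u else 0) else 0)) := by
    simp only [symProj, Matrix.smul_apply, Matrix.add_apply, Matrix.one_apply, Matrix.of_apply,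
      Prod.mk.injEq, smul_eq_mul]
    simp only [ite_and]
    split_ifs <;> ring
  simp_rw [h, ← Finset.mul_sum, Finset.sum_add_distrib]
  simp only [Finset.sum_ite_eq, Finset.mem_univ, if_true, Matrix.smul_apply, Matrix.add_apply,
    Matrix.one_apply, smul_eq_mul]
  congr 2
  · split_ifs with hxy
    · exact hP
    · simp
  · rw [Finset.sum_eq_single y] <;> simp +contextual

end SwapTest

section Reduction

variable {a b k : ℕ}

lemma half_one_add_W (i : Fin k) :
    (1 / 2 : ℂ) • (1 + W a b k i) =
      (piTensor (Pi.mulSingle i (symProj (Fin a × Fin b)))).submatrix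
        (Equiv.arrowProdEquivProdArrow _ _ _).symm (Equiv.arrowProdEquivProdArrow _ _ _).symm := by
  ext ⟨x, x'⟩ ⟨y, y'⟩
  have hrest : ∏ j ∈ {i}ᶜ, (Pi.mulSingle i (symProj (Fin a × Fin b)) :
        Fin k → Matrix _ _ ℂ) j (x j, x' j) (y j, y' j) =
      if ∀ j ≠ i, x j = y j ∧ x' j = y' j then 1 else 0 := by
    rw [← Finset.prod_congr rfl fun j hj => ?_]
    · exact (Finset.prod_boole (s := {i}ᶜ) (p := fun j => x j = y j ∧ x' j = y' j)).trans
        (by simp)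
    · rw [Pi.mulSingle_eq_of_ne (by simpa using hj)]
      simp [Matrix.one_apply]
  have h1 : ((x, x') = (y, y')) ↔
      (∀ j ≠ i, x j = y j ∧ x' j = y' j) ∧ x i = y i ∧ x' i = y' i := by
    simp only [Prod.mk.injEq, funext_iff]
    grind
  have h2 : ((x, x') = (Function.update y i (y' i), Function.update y' i (y i))) ↔
      (∀ j ≠ i, x j = y j ∧ x' j = y' j) ∧ x i = y' i ∧ x' i = y i := by
    simp only [Prod.mk.injEq, funext_iff, Function.update_apply]
    grind
  simp only [piTensor, Matrix.submatrix_apply, Matrix.of_apply]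
  rw [Fintype.prod_eq_mul_prod_compl i]
  erw [hrest]
  simp only [W, Matrix.smul_apply, Matrix.add_apply, Matrix.one_apply, Matrix.of_apply, h1, h2,
    Pi.mulSingle_eq_same, symProj, Equiv.arrowProdEquivProdArrow, Equiv.coe_fn_symm_mk,
    Prod.mk.injEq]
  simp only [ite_and, smul_eq_mul]
  split_ifs <;> ring

lemma prod_half_one_add_W :
    (List.map (fun i => (1 / 2 : ℂ) • (1 + W a b k i)) (List.finRange k)).prod =
      (piTensor fun _ : Fin k => symProj (Fin a × Fin b)).submatrix
        (Equiv.arrowProdEquivProdArrow _ _ _).symm (Equiv.arrowProdEquivProdArrow _ _ _).symm := by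
  have key (l : List (Fin k)) :
      (List.map (fun i => (1 / 2 : ℂ) • (1 + W a b k i)) l).prod =
      (piTensor (l.map fun i => Pi.mulSingle i (symProj (Fin a × Fin b))).prod).submatrix
        (Equiv.arrowProdEquivProdArrow _ _ _).symm
        (Equiv.arrowProdEquivProdArrow _ _ _).symm := by
    induction l with
    | nil => simp [piTensor_one]
    | cons i l ih =>
      rw [List.map_cons, List.prod_cons, ih, half_one_add_W, List.map_cons, List.prod_cons,
        piTensor_mul, Matrix.submatrix_mul_equiv]
  rw [key]
  congr 2
  funext j
  have happly (l : List (Fin k)) (hl : l.Nodup) :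
      (l.map fun i => (Pi.mulSingle i (symProj (Fin a × Fin b)) : Fin k → Matrix _ _ ℂ)).prod j =
        if j ∈ l then symProj (Fin a × Fin b) else 1 := by
    induction l with
    | nil => simp
    | cons i l ih =>
      rw [List.nodup_cons] at hl
      rw [List.map_cons, List.prod_cons, Pi.mul_apply, ih hl.2]
      by_cases hj : j = i
      · subst hj
        simp [hl.1]
      · simp [hj]
  simp [happly _ (List.nodup_finRange k)]

/-- Passing the swap test against `φ` is the effect `((I + |φ⟩⟨φ|) / 2)^{⊗k}`. -/
lemma swapTestProb_eq (φ : Fin a × Fin b → ℂ) (hφ : star φ ⬝ᵥ φ = 1)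
    (ρ : Matrix (TensIdx a b k) (TensIdx a b k) ℂ) :
    swapTestProb k φ ρ =
      ((piTensor fun _ : Fin k => (1 / 2 : ℂ) • (1 + vecMulVec φ (star φ))) * ρ).trace.re := by
  have hP : (vecMulVec φ (star φ)).trace = 1 := by
    rw [Matrix.trace_vecMulVec, dotProduct_comm, hφ]
  rw [swapTestProb, prod_half_one_add_W]
  generalize vecMulVec φ (star φ) = P at hP ⊢
  congr 1
  simp only [Matrix.trace, Matrix.diag, Matrix.mul_apply, Fintype.sum_prod_type,
    Matrix.kroneckerMap_apply, Matrix.submatrix_apply, piTensor, tpow, Matrix.of_apply,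
    Equiv.arrowProdEquivProdArrow, Equiv.coe_fn_symm_mk]
  simp only [← sum_symProj_mul P hP, Fintype.prod_sum, Finset.sum_mul, Finset.prod_mul_distrib,
    ← mul_assoc]
  rw [Finset.sum_comm]
  refine Finset.sum_congr rfl fun x _ => ?_
  symm
  rw [Finset.sum_comm]
  exact Finset.sum_congr rfl fun u _ => Finset.sum_comm

/-- Effects acting only on the `A` registers depend only on the reduced state there. -/
lemma trace_piTensor_kronecker_one_mul (M : Matrix (Fin a) (Fin a) ℂ)
    (ρ : Matrix (TensIdx a b k) (TensIdx a b k) ℂ) :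
    ((piTensor fun _ : Fin k => M ⊗ₖ (1 : Matrix (Fin b) (Fin b) ℂ)) * ρ).trace =
      ((piTensor fun _ : Fin k => M) * ptraceBs ρ).trace := by
  have hsum (f : TensIdx a b k → ℂ) :
      ∑ x, f x = ∑ u : Fin k → Fin a, ∑ z : Fin k → Fin b, f fun i => (u i, z i) := by
    rw [← Fintype.sum_prod_type']
    exact Fintype.sum_equiv (Equiv.arrowProdEquivProdArrow _ _ _) _ _ fun _ => rfl
  simp only [Matrix.trace, Matrix.diag, Matrix.mul_apply, hsum, piTensor, ptraceBs,
    Matrix.of_apply, Matrix.kroneckerMap_apply, Matrix.one_apply, Fintype.prod_ite_zero, ← funext_iff, mul_ite, mul_one, mul_zero, ite_mul, zero_mul,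
    Finset.sum_ite_eq, Finset.mem_univ, if_true, Finset.mul_sum]
  exact Finset.sum_congr rfl fun u _ => Finset.sum_comm

end Reduction

section Projections

/-- The range projection of `A` fixes `A` and kills every `B` with range orthogonal to that
of `A`. -/
lemma Matrix.exists_projection_mul_eq {m n p : Type*} [Fintype m] [Fintype n] [DecidableEq m]
    (A : Matrix m n ℂ) (B : Matrix m p ℂ) (h : Aᴴ * B = 0) :
    ∃ Q : Matrix m m ℂ, Qᴴ = Q ∧ Q * Q = Q ∧ Q * A = A ∧ Q * B = 0 := by
  have hσ : IsSelfAdjoint (A * Aᴴ) := Matrix.isHermitian_mul_conjTranspose_self A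
  have hc (f : ℝ → ℝ) : ContinuousOn f (spectrum ℝ (A * Aᴴ)) :=
    (Matrix.finite_real_spectrum (A := A * Aᴴ)).continuousOn f
  have hQσ : cfc (fun x : ℝ => x⁻¹ * x) (A * Aᴴ) * (A * Aᴴ) = A * Aᴴ := by
    nth_rw 2 [← cfc_id' ℝ (A * Aᴴ)]
    rw [← cfc_mul _ _ _ (hc _) (hc _)]
    simp only [inv_mul_mul_self]
    exact cfc_id' ℝ (A * Aᴴ)
  refine ⟨cfc (fun x : ℝ => x⁻¹ * x) (A * Aᴴ), (cfc_predicate (R := ℝ) (p := IsSelfAdjoint) _ _).star_eq,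
    ?_, ?_, ?_⟩
  · rw [← cfc_mul _ _ _ (hc _) (hc _)]
    congr 1
    funext x
    by_cases hx : x = 0 <;> simp [hx]
  · have h0 : (cfc (fun x : ℝ => x⁻¹ * x) (A * Aᴴ) - 1) * A = 0 := by
      rw [← Matrix.mul_self_mul_conjTranspose_eq_zero, Matrix.sub_mul, Matrix.one_mul, hQσ,
        sub_self]
    rwa [Matrix.sub_mul, Matrix.one_mul, sub_eq_zero] at h0
  · rw [cfc_mul _ _ _ (hc _) (hc _), cfc_id' ℝ (A * Aᴴ), Matrix.mul_assoc, Matrix.mul_assoc, h,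
      Matrix.mul_zero, Matrix.mul_zero]

variable {n : Type*} [Fintype n]

lemma Matrix.posSemidef_sub_vecMulVec {E : Matrix n n ℂ} (hE : Eᴴ = E) (hEE : E * E = E)
    {φ : n → ℂ} (hφ : star φ ⬝ᵥ φ = 1) (hEφ : E *ᵥ φ = φ) :
    (E - vecMulVec φ (star φ)).PosSemidef := by
  have hP : (vecMulVec φ (star φ))ᴴ = vecMulVec φ (star φ) := by
    rw [conjTranspose_vecMulVec, star_star]
  have hEP : E * vecMulVec φ (star φ) = vecMulVec φ (star φ) := by
    rw [Matrix.mul_vecMulVec, hEφ]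
  have hPE : vecMulVec φ (star φ) * E = vecMulVec φ (star φ) := by
    rw [← hP, ← hE, ← conjTranspose_mul, hEP]
  refine posSemidef_of_isHermitian_of_mul_self (by rw [conjTranspose_sub, hE, hP]) ?_
  rw [Matrix.mul_sub, Matrix.sub_mul, Matrix.sub_mul, hEE, hEP, hPE, vecMulVec_mul_vecMulVec, hφ]
  simp

variable [DecidableEq n] {ι : Type*} [Fintype ι] [DecidableEq ι]

lemma re_trace_piTensor_one_add_projection_le {E : Matrix n n ℂ} (hE : Eᴴ = E)
    (hEE : E * E = E) {ρ : Matrix (ι → n) (ι → n) ℂ} (hρ : ρ.PosSemidef) (htr : ρ.trace = 1) :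
    ((piTensor fun _ : ι => 1 + E) * ρ).trace.re +
      ((piTensor fun _ : ι => 1 + (1 - E)) * ρ).trace.re ≤ 2 ^ Fintype.card ι + 1 := by
  set f : Finset ι → ℝ := fun s =>
    ((piTensor fun i => if i ∈ s then E else 1 - E) * ρ).trace.re
  have hf0 (s : Finset ι) : 0 ≤ f s := by
    refine (piTensor_posSemidef fun i => ?_).re_trace_mul_nonneg hρ
    split_ifs
    · exact posSemidef_of_isHermitian_of_mul_self hE hEE
    · refine posSemidef_of_isHermitian_of_mul_self (by simp [hE]) ?_
      simp [Matrix.mul_sub, Matrix.sub_mul, hEE]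
  have hexp (c d : ℕ) : ((piTensor fun _ : ι => (c : ℂ) • E + (d : ℂ) • (1 - E)) * ρ).trace.re =
      ∑ s : Finset ι, (c : ℝ) ^ s.card * (d : ℝ) ^ sᶜ.card * f s := by
    rw [piTensor_smul_add_smul, Finset.sum_mul, Matrix.trace_sum, Complex.re_sum]
    refine Finset.sum_congr rfl fun s _ => ?_
    rw [Matrix.smul_mul, Matrix.trace_smul, smul_eq_mul, ← Complex.re_ofReal_mul]
    push_cast
    rfl
  have h21 := hexp 2 1
  have h12 := hexp 1 2
  have h11 := hexp 1 1
  have e21 : ((2 : ℕ) : ℂ) • E + ((1 : ℕ) : ℂ) • (1 - E) = 1 + E := by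
    push_cast; module
  have e12 : ((1 : ℕ) : ℂ) • E + ((2 : ℕ) : ℂ) • (1 - E) = 1 + (1 - E) := by
    push_cast; module
  have e11 : ((1 : ℕ) : ℂ) • E + ((1 : ℕ) : ℂ) • (1 - E) = 1 := by
    push_cast; module
  rw [e21] at h21
  rw [e12] at h12
  rw [e11, show (piTensor fun _ : ι => (1 : Matrix n n ℂ)) = 1 from piTensor_one, Matrix.one_mul,
    htr, Complex.one_re] at h11
  simp only [Nat.cast_one, one_pow, one_mul] at h11
  rw [h21, h12]
  refine le_of_le_of_eq ?_ (mul_one (2 ^ Fintype.card ι + 1))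
  rw [h11, ← Finset.sum_add_distrib, Finset.mul_sum]
  refine Finset.sum_le_sum fun s _ => ?_
  have hx : (1 : ℝ) ≤ 2 ^ s.card := one_le_pow₀ one_le_two
  have hy : (1 : ℝ) ≤ 2 ^ sᶜ.card := one_le_pow₀ one_le_two
  have hxy : (2 : ℝ) ^ Fintype.card ι = 2 ^ s.card * 2 ^ sᶜ.card := by
    rw [← pow_add, Finset.card_add_card_compl]
  simp only [Nat.cast_one, Nat.cast_ofNat, one_pow, one_mul, mul_one, hxy, ← add_mul]
  exact mul_le_mul_of_nonneg_right (by nlinarith) (hf0 s)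

end Projections

section Bound

variable {a b k : ℕ}

lemma kronecker_one_mulVec (Q : Matrix (Fin a) (Fin a) ℂ) (φ : Fin a × Fin b → ℂ) :
    (Q ⊗ₖ (1 : Matrix (Fin b) (Fin b) ℂ)) *ᵥ φ =
      fun x => (Q * Matrix.of fun i l => φ (i, l)) x.1 x.2 := by
  ext ⟨i, l⟩
  simp [Matrix.mulVec, dotProduct, Fintype.sum_prod_type, Matrix.mul_apply, Matrix.one_apply]

lemma swapTestProb_le {φ : Fin a × Fin b → ℂ} (hφ : star φ ⬝ᵥ φ = 1)
    {E : Matrix (Fin a × Fin b) (Fin a × Fin b) ℂ} (hE : Eᴴ = E) (hEE : E * E = E)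
    (hEφ : E *ᵥ φ = φ) {ρ : Matrix (TensIdx a b k) (TensIdx a b k) ℂ} (hρ : ρ.PosSemidef) :
    swapTestProb k φ ρ ≤ (1 / 2) ^ k * ((piTensor fun _ : Fin k => 1 + E) * ρ).trace.re := by
  have hcast : (1 / 2 : ℂ) ^ k = (((1 / 2) ^ k : ℝ) : ℂ) := by push_cast; rfl
  rw [swapTestProb_eq φ hφ, piTensor_smul (fun _ => (1 / 2 : ℂ)), Finset.prod_const,
    Finset.card_univ, Fintype.card_fin, Matrix.smul_mul, Matrix.trace_smul, smul_eq_mul, hcast,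
    Complex.re_ofReal_mul]
  refine mul_le_mul_of_nonneg_left (re_trace_piTensor_mul_mono ?_ ?_ hρ) (by positivity)
  · exact Matrix.PosSemidef.one.add (posSemidef_vecMulVec_self_star φ)
  · rw [add_sub_add_left_eq_sub]
    exact Matrix.posSemidef_sub_vecMulVec hE hEE hφ hEφ

end Bound

/-- Parallel repetition for swap-test based verification (exactly orthogonal case):
if the reduced states of `φ0` and `φ1` on `A` are orthogonal, then any two states
on `(A ⊗ B)^{⊗k}` with the same reduced state on the `A` registers pass the `k`-fold
swap tests against `φ0` resp. `φ1` with average probability at most `1/2 + 1/2^{k+1}`. -/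
theorem swap_test_parallel_repetition {a b k : ℕ} (hk : 1 ≤ k)
    (φ0 φ1 : Fin a × Fin b → ℂ)
    (hunit0 : star φ0 ⬝ᵥ φ0 = 1) (hunit1 : star φ1 ⬝ᵥ φ1 = 1)
    (horth : ptraceB (vecMulVec φ0 (star φ0)) * ptraceB (vecMulVec φ1 (star φ1)) = 0)
    (ρ0 ρ1 : Matrix (TensIdx a b k) (TensIdx a b k) ℂ)
    (hρ0 : ρ0.PosSemidef) (htr0 : ρ0.trace = 1)
    (hρ1 : ρ1.PosSemidef) (htr1 : ρ1.trace = 1)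
    (hsame : ptraceBs ρ0 = ptraceBs ρ1) :
    (1 / 2) * (swapTestProb k φ0 ρ0 + swapTestProb k φ1 ρ1)
      ≤ 1 / 2 + 1 / 2 ^ (k + 1) := by
  set A : Matrix (Fin a) (Fin b) ℂ := Matrix.of fun i l => φ0 (i, l) with hA
  set B : Matrix (Fin a) (Fin b) ℂ := Matrix.of fun i l => φ1 (i, l) with hB
  have hAB : Aᴴ * B = 0 := by
    have h0 : ptraceB (vecMulVec φ0 (star φ0)) = A * Aᴴ := by
      ext i j
      simp [ptraceB, hA, Matrix.mul_apply, vecMulVec_apply]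
    have h1 : ptraceB (vecMulVec φ1 (star φ1)) = B * Bᴴ := by
      ext i j
      simp [ptraceB, hB, Matrix.mul_apply, vecMulVec_apply]
    rw [h0, h1, Matrix.mul_self_mul_conjTranspose_eq_zero,
      Matrix.self_mul_conjTranspose_mul_eq_zero] at horth
    exact horth
  obtain ⟨Q, hQ, hQQ, hQA, hQB⟩ := Matrix.exists_projection_mul_eq A B hAB
  set E := Q ⊗ₖ (1 : Matrix (Fin b) (Fin b) ℂ) with hEdef
  have hE : Eᴴ = E := by rw [hEdef, conjTranspose_kronecker, hQ, conjTranspose_one]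
  have hEE : E * E = E := by rw [hEdef, ← mul_kronecker_mul, hQQ, Matrix.one_mul]
  have hE0 : E *ᵥ φ0 = φ0 := by
    rw [hEdef, kronecker_one_mulVec, ← hA, hQA]
    rfl
  have hE1 : (1 - E) *ᵥ φ1 = φ1 := by
    rw [Matrix.sub_mulVec, Matrix.one_mulVec, hEdef, kronecker_one_mulVec, ← hB, hQB]
    exact sub_zero φ1
  have hT0 := swapTestProb_le hunit0 hE hEE hE0 hρ0
  have hT1 := swapTestProb_le (E := 1 - E) hunit1 (by simp [hE])
    (by simp [Matrix.mul_sub, Matrix.sub_mul, hEE]) hE1 hρ1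
  have hlocal : 1 + (1 - E) = (1 + (1 - Q)) ⊗ₖ (1 : Matrix (Fin b) (Fin b) ℂ) := by
    have h : (1 - Q) ⊗ₖ (1 : Matrix (Fin b) (Fin b) ℂ) + E = 1 := by
      rw [hEdef, ← add_kronecker, sub_add_cancel, one_kronecker_one]
    rw [add_kronecker, one_kronecker_one, eq_sub_of_add_eq h]
  have hswitch : ((piTensor fun _ : Fin k => 1 + (1 - E)) * ρ1).trace =
      ((piTensor fun _ : Fin k => 1 + (1 - E)) * ρ0).trace := by
    rw [hlocal, trace_piTensor_kronecker_one_mul, trace_piTensor_kronecker_one_mul, hsame]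
  rw [hswitch] at hT1
  have hsum := re_trace_piTensor_one_add_projection_le (ι := Fin k) hE hEE hρ0 htr0
  rw [Fintype.card_fin] at hsum
  have hpow : (0 : ℝ) < (1 / 2) ^ k := by positivity
  have hmul := mul_le_mul_of_nonneg_left hsum hpow.le
  have hcancel : (1 / 2 : ℝ) ^ k * 2 ^ k = 1 := by rw [← mul_pow]; norm_num
  have hhalf : (1 : ℝ) / 2 ^ (k + 1) = 1 / 2 * (1 / 2) ^ k := by
    rw [pow_succ, div_pow, one_pow]; ring
  rw [hhalf]
  linarith
end

section
/- Let A = ℂ^a, B = ℂ^b, and R = ℂ^r. Let φ0, φ1 be unit vectors in A ⊗ B whose reduced density matrices Tr_B |φ0⟩⟨φ0| and Tr_B |φ1⟩⟨φ1| are orthogonal (their matrix product is 0). Then for all density matrices ρ0, ρ1 on A ⊗ B ⊗ R whose partial traces over B ⊗ R are equal, it holds that tr[(|φ0⟩⟨φ0| ⊗ I_R) ρ0] + tr[(|φ1⟩⟨φ1| ⊗ I_R) ρ1] ≤ 1. -/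
open Matrix ComplexOrder Kronecker

/-- Partial trace over the last two factors `B ⊗ R` of a matrix on `ℂ^a ⊗ ℂ^b ⊗ ℂ^r`. -/
noncomputable def ptraceBR {a b r : ℕ}
    (M : Matrix ((Fin a × Fin b) × Fin r) ((Fin a × Fin b) × Fin r) ℂ) :
    Matrix (Fin a) (Fin a) ℂ :=
  Matrix.of fun i j => ∑ l : Fin b, ∑ s : Fin r, M ((i, l), s) ((j, l), s)

/-- If `S` is Hermitian and `S * T = 0`, some orthogonal projection fixes `S` and annihilates `T`. -/
lemma exists_isStarProjection_mul_eq_self_mul_eq_zero {n : Type*} [Fintype n] [DecidableEq n]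
    {S T : Matrix n n ℂ} (hS : S.IsHermitian) (hST : S * T = 0) :
    ∃ E : Matrix n n ℂ, IsStarProjection E ∧ E * S = S ∧ E * T = 0 := by
  let Φ := Matrix.toEuclideanCLM (n := n) (𝕜 := ℂ)
  let W := LinearMap.range (Φ S).toLinearMap
  have hadj : ContinuousLinearMap.adjoint (Φ S) = Φ S := by
    rw [← ContinuousLinearMap.star_eq_adjoint, ← map_star, star_eq_conjTranspose, hS.eq]
  refine ⟨Φ.symm W.starProjection, ?_, ?_, ?_⟩
  · have hW := isStarProjection_starProjection (U := W)
    refine ⟨?_, ?_⟩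
    · rw [IsIdempotentElem, ← map_mul, hW.isIdempotentElem.eq]
    · apply EquivLike.injective Φ
      rw [map_star, StarAlgEquiv.apply_symm_apply, hW.isSelfAdjoint.star_eq]
  · apply EquivLike.injective Φ
    rw [map_mul, StarAlgEquiv.apply_symm_apply]
    ext1 v
    exact Submodule.starProjection_eq_self_iff.mpr ⟨v, rfl⟩
  · apply EquivLike.injective Φ
    rw [map_mul, StarAlgEquiv.apply_symm_apply, map_zero]
    ext1 v
    refine (Submodule.starProjection_apply_eq_zero_iff W).mpr ?_
    rw [Submodule.mem_orthogonal]
    rintro _ ⟨w, rfl⟩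
    change inner ℂ (Φ S w) (Φ T v) = 0
    rw [← ContinuousLinearMap.adjoint_inner_right, hadj, ← mul_apply_eq_comp,
      ← map_mul, hST, map_zero]
    simp

lemma ptraceB_vecMulVec_star {a b : ℕ} (φ : Fin a × Fin b → ℂ) :
    ptraceB (vecMulVec φ (star φ)) =
      (of fun i l => φ (i, l)) * (of fun i l => φ (i, l))ᴴ := by
  ext i j
  simp [ptraceB, vecMulVec_apply, mul_apply]

lemma trace_kronecker_one_kronecker_one_mul {a b r : ℕ} (F : Matrix (Fin a) (Fin a) ℂ)
    (ρ : Matrix ((Fin a × Fin b) × Fin r) ((Fin a × Fin b) × Fin r) ℂ) :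
    (((F ⊗ₖ (1 : Matrix (Fin b) (Fin b) ℂ)) ⊗ₖ (1 : Matrix (Fin r) (Fin r) ℂ)) * ρ).trace =
      (F * ptraceBR ρ).trace := by
  simp only [trace, diag_apply, mul_apply, ptraceBR, of_apply, kroneckerMap_apply,
    Fintype.sum_prod_type, one_apply, mul_ite, mul_one, mul_zero, ite_mul, zero_mul,
    Finset.sum_ite_eq, Finset.mem_univ, if_true, Finset.mul_sum]
  refine Finset.sum_congr rfl fun i _ => ?_
  rw [Finset.sum_comm_cycle]

lemma trace_ptraceBR {a b r : ℕ}
    (ρ : Matrix ((Fin a × Fin b) × Fin r) ((Fin a × Fin b) × Fin r) ℂ) :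
    (ptraceBR ρ).trace = ρ.trace := by
  simp [trace, ptraceBR, Fintype.sum_prod_type]

lemma IsStarProjection.kronecker_one {m n : Type*} [Fintype m] [DecidableEq m] [Fintype n]
    [DecidableEq n] {P : Matrix m m ℂ} (hP : IsStarProjection P) :
    IsStarProjection (P ⊗ₖ (1 : Matrix n n ℂ)) := by
  refine ⟨?_, ?_⟩
  · rw [IsIdempotentElem, ← mul_kronecker_mul, hP.isIdempotentElem.eq, one_mul]
  · rw [IsSelfAdjoint, star_eq_conjTranspose, conjTranspose_kronecker, conjTranspose_one,
      ← star_eq_conjTranspose, hP.isSelfAdjoint.star_eq]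

lemma isStarProjection_vecMulVec_star {n : Type*} [Fintype n] [DecidableEq n] {φ : n → ℂ}
    (h : star φ ⬝ᵥ φ = 1) : IsStarProjection (vecMulVec φ (star φ)) := by
  refine ⟨?_, ?_⟩
  · rw [IsIdempotentElem, vecMulVec_mul_vecMulVec, h, one_smul]
  · rw [IsSelfAdjoint, star_eq_conjTranspose, conjTranspose_vecMulVec, star_star]

lemma IsStarProjection.trace_mul_nonneg {n : Type*} [Fintype n] [DecidableEq n]
    {Q ρ : Matrix n n ℂ} (hQ : IsStarProjection Q) (hρ : ρ.PosSemidef) :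
    0 ≤ (Q * ρ).trace := by
  have h := (hρ.mul_mul_conjTranspose_same Q).trace_nonneg
  rwa [← star_eq_conjTranspose, hQ.isSelfAdjoint.star_eq, trace_mul_comm, ← mul_assoc,
    hQ.isIdempotentElem.eq] at h

/-- If a projection on `A` fixes the reduced state of `φ`, then projecting on `φ` is at most as
likely as the outcome of that projection on the marginal on `A`. -/
lemma re_trace_vecMulVec_kronecker_one_mul_le {a b r : ℕ} {φ : Fin a × Fin b → ℂ}
    (h : star φ ⬝ᵥ φ = 1) {F : Matrix (Fin a) (Fin a) ℂ} (hF : IsStarProjection F)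
    (hFφ : F * ptraceB (vecMulVec φ (star φ)) = ptraceB (vecMulVec φ (star φ)))
    {ρ : Matrix ((Fin a × Fin b) × Fin r) ((Fin a × Fin b) × Fin r) ℂ} (hρ : ρ.PosSemidef) :
    (((vecMulVec φ (star φ) ⊗ₖ (1 : Matrix (Fin r) (Fin r) ℂ)) * ρ).trace).re ≤
      ((F * ptraceBR ρ).trace).re := by
  have hX : F * (of fun i l => φ (i, l)) = of fun i l => φ (i, l) := by
    rw [ptraceB_vecMulVec_star, ← sub_eq_zero, ← sub_one_mul,
      mul_self_mul_conjTranspose_eq_zero, Matrix.sub_mul, Matrix.one_mul, sub_eq_zero] at hFφ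
    exact hFφ
  have hfix : (F ⊗ₖ (1 : Matrix (Fin b) (Fin b) ℂ)) *ᵥ φ = φ := by
    ext ⟨i, l⟩
    have := congrFun (congrFun hX i) l
    simpa [mulVec, dotProduct, Fintype.sum_prod_type, mul_apply, one_apply] using this
  have hQ : IsStarProjection (F ⊗ₖ (1 : Matrix (Fin b) (Fin b) ℂ) - vecMulVec φ (star φ)) :=
    (isStarProjection_vecMulVec_star h).sub_of_mul_eq_right hF.kronecker_one
      (by rw [mul_vecMulVec, hfix])
  have hnonneg := (hQ.kronecker_one (n := Fin r)).trace_mul_nonneg hρ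
  have hsub : (F ⊗ₖ (1 : Matrix (Fin b) (Fin b) ℂ) - vecMulVec φ (star φ)) ⊗ₖ
      (1 : Matrix (Fin r) (Fin r) ℂ) =
      (F ⊗ₖ (1 : Matrix (Fin b) (Fin b) ℂ)) ⊗ₖ (1 : Matrix (Fin r) (Fin r) ℂ) -
        vecMulVec φ (star φ) ⊗ₖ (1 : Matrix (Fin r) (Fin r) ℂ) := by
    ext i j
    simp only [kroneckerMap_apply, Matrix.sub_apply, sub_mul]
  rw [hsub, sub_mul, trace_sub, trace_kronecker_one_kronecker_one_mul] at hnonneg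
  have := (Complex.le_def.mp hnonneg).1
  rw [Complex.zero_re, Complex.sub_re] at this
  linarith

/-- If the reduced states of `φ0` and `φ1` on `A` are orthogonal, then for any
two states `ρ0, ρ1` on `A ⊗ B ⊗ R` with equal partial traces over `B ⊗ R`,
`tr[(|φ0⟩⟨φ0| ⊗ I_R) ρ0] + tr[(|φ1⟩⟨φ1| ⊗ I_R) ρ1] ≤ 1`. -/
theorem orthogonal_reveal_bound {a b r : ℕ}
    (φ0 φ1 : Fin a × Fin b → ℂ)
    (hunit0 : star φ0 ⬝ᵥ φ0 = 1) (hunit1 : star φ1 ⬝ᵥ φ1 = 1)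
    (horth : ptraceB (vecMulVec φ0 (star φ0)) * ptraceB (vecMulVec φ1 (star φ1)) = 0)
    (ρ0 ρ1 : Matrix ((Fin a × Fin b) × Fin r) ((Fin a × Fin b) × Fin r) ℂ)
    (hρ0 : ρ0.PosSemidef) (htr0 : ρ0.trace = 1)
    (hρ1 : ρ1.PosSemidef) (htr1 : ρ1.trace = 1)
    (hsame : ptraceBR ρ0 = ptraceBR ρ1) :
    (((vecMulVec φ0 (star φ0) ⊗ₖ (1 : Matrix (Fin r) (Fin r) ℂ)) * ρ0).trace).re
      + (((vecMulVec φ1 (star φ1) ⊗ₖ (1 : Matrix (Fin r) (Fin r) ℂ)) * ρ1).trace).re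
      ≤ 1 := by
  have hherm : (ptraceB (vecMulVec φ0 (star φ0))).IsHermitian := by
    rw [ptraceB_vecMulVec_star]
    exact isHermitian_mul_conjTranspose_self _
  obtain ⟨E, hE, hE0, hE1⟩ := exists_isStarProjection_mul_eq_self_mul_eq_zero hherm horth
  have h0 := re_trace_vecMulVec_kronecker_one_mul_le hunit0 hE hE0 hρ0
  have h1 := re_trace_vecMulVec_kronecker_one_mul_le hunit1 hE.one_sub
    (by rw [one_sub_mul, hE1, sub_zero]) hρ1
  rw [one_sub_mul, trace_sub, trace_ptraceBR, htr1, ← hsame, Complex.sub_re,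
    Complex.one_re] at h1
  linarith
end

section
/- Let d ≥ 1 and let ρ0, ρ1 be density matrices on ℂ² ⊗ ℂ^d (registers A and H). Define the state ζ = (1/(2d)) ( |0⟩⟨0| ⊗ ρ0 ⊗ I_d + |1⟩⟨1| ⊗ ρ1 ⊗ I_d ) on ℂ² ⊗ ℂ² ⊗ ℂ^d ⊗ ℂ^d (registers B, A, H, K). Then tr[ (|φ⁺⟩⟨φ⁺| ⊗ I_{d²}) ζ ] = (1/4) ( ⟨0| (Tr_H ρ0) |0⟩ + ⟨1| (Tr_H ρ1) |1⟩ ) ≤ 1/2, where |φ⁺⟩ = (|00⟩ + |11⟩)/√2 on registers B ⊗ A and Tr_H denotes the partial trace of ρ_b over its ℂ^d factor. (Soundness of the QSZK protocol: when the oracle decoheres the control qubit, no prover action makes the verifier's Bell measurement accept with probability exceeding 1/2.) -/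
open Matrix ComplexOrder Kronecker

/-- Kronecker product of a matrix on the two qubit registers `B ⊗ A` with a
matrix on `H ⊗ K`, realized on the index type `Fin 2 × Fin 2 × Fin d × Fin d`. -/
noncomputable def kronBAHK {d : ℕ} (M : Matrix (Fin 2 × Fin 2) (Fin 2 × Fin 2) ℂ)
    (N : Matrix (Fin d × Fin d) (Fin d × Fin d) ℂ) :
    Matrix (Fin 2 × Fin 2 × Fin d × Fin d) (Fin 2 × Fin 2 × Fin d × Fin d) ℂ :=
  Matrix.of fun x y => M (x.1, x.2.1) (y.1, y.2.1) * N x.2.2 y.2.2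

/-- The maximally entangled state `|φ⁺⟩ = (|00⟩ + |11⟩)/√2` of `ℂ² ⊗ ℂ²`. -/
noncomputable def phiPlus : Fin 2 × Fin 2 → ℂ :=
  fun p => if p.1 = p.2 then ((Real.sqrt 2 : ℝ) : ℂ)⁻¹ else 0

/-- Partial trace over the `ℂ^d` factor of a matrix on `ℂ² ⊗ ℂ^d`. -/
noncomputable def ptraceH {d : ℕ} (M : Matrix (Fin 2 × Fin d) (Fin 2 × Fin d) ℂ) :
    Matrix (Fin 2) (Fin 2) ℂ :=
  Matrix.of fun i j => ∑ h : Fin d, M (i, h) (j, h)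

/-- The trace of `(M ⊗ I) Z` only involves the partial trace of `Z` over `H ⊗ K`. -/
theorem trace_kronBAHK_one_mul {d : ℕ} (M : Matrix (Fin 2 × Fin 2) (Fin 2 × Fin 2) ℂ)
    (Z : Matrix (Fin 2 × Fin 2 × Fin d × Fin d) (Fin 2 × Fin 2 × Fin d × Fin d) ℂ) :
    (kronBAHK M 1 * Z).trace = ∑ a, ∑ b, ∑ a', ∑ b',
      M (a, b) (a', b') * ∑ r : Fin d × Fin d, Z (a', b', r) (a, b, r) := by
  have entry (a b : Fin 2) (r : Fin d × Fin d) :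
      (kronBAHK M 1 * Z : Matrix _ _ ℂ) (a, b, r) (a, b, r)
      = ∑ a', ∑ b', M (a, b) (a', b') * Z (a', b', r) (a, b, r) := by
    rw [Matrix.mul_apply, Fintype.sum_prod_type]
    refine Finset.sum_congr rfl fun a' _ => ?_
    rw [Fintype.sum_prod_type]
    refine Finset.sum_congr rfl fun b' _ => ?_
    rw [Finset.sum_eq_single r]
    · simp [kronBAHK]
    · intro s _ hs
      simp [kronBAHK, Matrix.one_apply_ne hs.symm]
    · simp
  simp only [Matrix.trace, Matrix.diag_apply]
  rw [Fintype.sum_prod_type]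
  refine Finset.sum_congr rfl fun a _ => ?_
  rw [Fintype.sum_prod_type]
  refine Finset.sum_congr rfl fun b _ => ?_
  simp only [entry]
  rw [Finset.sum_comm]
  refine Finset.sum_congr rfl fun a' _ => ?_
  rw [Finset.sum_comm]
  simp only [Finset.mul_sum]

/-- Entries of the projector `|φ⁺⟩⟨φ⁺|`. -/
theorem vecMulVec_phiPlus_apply (p q : Fin 2 × Fin 2) :
    vecMulVec phiPlus (star phiPlus) p q = if p.1 = p.2 ∧ q.1 = q.2 then 1 / 2 else 0 := by
  have h : ((Real.sqrt 2 : ℝ) : ℂ)⁻¹ * ((Real.sqrt 2 : ℝ) : ℂ)⁻¹ = 1 / 2 := by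
    rw [← mul_inv, ← Complex.ofReal_mul, Real.mul_self_sqrt zero_le_two]
    norm_num
  by_cases hp : p.1 = p.2 <;> by_cases hq : q.1 = q.2 <;>
    simp [vecMulVec_apply, phiPlus, hp, hq]
  simpa using h

/-- The partial trace over `H` preserves the trace. -/
theorem ptraceH_zero_add_one {d : ℕ} (M : Matrix (Fin 2 × Fin d) (Fin 2 × Fin d) ℂ) :
    ptraceH M 0 0 + ptraceH M 1 1 = M.trace := by
  simp [ptraceH, Matrix.trace, Fintype.sum_prod_type]

/-- The diagonal of the reduced state of a positive semidefinite matrix is nonnegative. -/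
theorem ptraceH_apply_self_nonneg {d : ℕ} {M : Matrix (Fin 2 × Fin d) (Fin 2 × Fin d) ℂ}
    (hM : M.PosSemidef) (i : Fin 2) : 0 ≤ ptraceH M i i := by
  rw [ptraceH, Matrix.of_apply]
  exact Finset.sum_nonneg fun _ _ => hM.diag_nonneg

/-- The diagonal entries of a reduced density matrix are at most one. -/
theorem ptraceH_apply_self_re_le_one {d : ℕ} {M : Matrix (Fin 2 × Fin d) (Fin 2 × Fin d) ℂ}
    (hM : M.PosSemidef) (htr : M.trace = 1) (i : Fin 2) : (ptraceH M i i).re ≤ 1 := by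
  have h := congrArg Complex.re ((ptraceH_zero_add_one M).trans htr)
  have h0 := (Complex.le_def.mp (ptraceH_apply_self_nonneg hM 0)).1
  have h1 := (Complex.le_def.mp (ptraceH_apply_self_nonneg hM 1)).1
  simp only [Complex.add_re, Complex.one_re, Complex.zero_re] at h h0 h1
  fin_cases i
  · change (ptraceH M 0 0).re ≤ 1
    linarith
  · change (ptraceH M 1 1).re ≤ 1
    linarith

/-- Soundness of the QSZK protocol: when the oracle decoheres the control
qubit, the verifier's Bell measurement on `ζ` accepts with probability
`(1/4)(⟨0|Tr_H ρ0|0⟩ + ⟨1|Tr_H ρ1|1⟩)`, which is at most `1/2`. -/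
theorem decohered_oracle_soundness {d : ℕ} (hd : 1 ≤ d)
    (ρ0 ρ1 : Matrix (Fin 2 × Fin d) (Fin 2 × Fin d) ℂ)
    (hρ0 : ρ0.PosSemidef) (htr0 : ρ0.trace = 1)
    (hρ1 : ρ1.PosSemidef) (htr1 : ρ1.trace = 1) :
    let ζ : Matrix (Fin 2 × Fin 2 × Fin d × Fin d) (Fin 2 × Fin 2 × Fin d × Fin d) ℂ :=
      ((1 : ℂ) / (2 * (d : ℂ))) • Matrix.of fun x y =>
        (if x.1 = 0 ∧ y.1 = 0 then 1 else 0) * ρ0 (x.2.1, x.2.2.1) (y.2.1, y.2.2.1) *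
            (if x.2.2.2 = y.2.2.2 then 1 else 0)
          + (if x.1 = 1 ∧ y.1 = 1 then 1 else 0) * ρ1 (x.2.1, x.2.2.1) (y.2.1, y.2.2.1) *
            (if x.2.2.2 = y.2.2.2 then 1 else 0)
    ((kronBAHK (vecMulVec phiPlus (star phiPlus)) 1 * ζ).trace
        = (1 / 4 : ℂ) * (ptraceH ρ0 0 0 + ptraceH ρ1 1 1))
      ∧ ((kronBAHK (vecMulVec phiPlus (star phiPlus)) 1 * ζ).trace).re ≤ 1 / 2 := by
  intro ζ
  have key : (kronBAHK (vecMulVec phiPlus (star phiPlus)) 1 * ζ).trace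
      = (1 / 4 : ℂ) * (ptraceH ρ0 0 0 + ptraceH ρ1 1 1) := by
    have hd' : (d : ℂ) ≠ 0 := Nat.cast_ne_zero.mpr (by omega)
    rw [trace_kronBAHK_one_mul]
    simp only [vecMulVec_phiPlus_apply, Fin.sum_univ_two, ζ, Fintype.sum_prod_type]
    simp [ptraceH, ← Finset.mul_sum]
    field_simp
    ring
  refine ⟨key, ?_⟩
  have h0 := ptraceH_apply_self_re_le_one hρ0 htr0 0
  have h1 := ptraceH_apply_self_re_le_one hρ1 htr1 1
  have hre : ((1 / 4 : ℂ) * (ptraceH ρ0 0 0 + ptraceH ρ1 1 1)).re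
      = 1 / 4 * ((ptraceH ρ0 0 0).re + (ptraceH ρ1 1 1).re) := by
    rw [show (1 / 4 : ℂ) = ((1 / 4 : ℝ) : ℂ) by norm_num, Complex.re_ofReal_mul, Complex.add_re]
  rw [key, hre]
  linarith
end
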